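/- arXiv:1207.0828 — 2 statements merged into one kernel-verified Lean document; each statement's English description precedes it below -/
import Mathlib

section
/- Let H be a complex Hilbert space, let T be an invertible bounded linear operator on H with T² = I, let J be a conjugation on H with JT = TJ, and let U be the unitary factor in the polar decomposition T = U|T|. Then the map 𝒥 := J∘U is itself a conjugation on H (a conjugate-linear isometric involution). -/
open ContinuousLinearMap in
/-- A positive operator is determined by its square. -/
theorem ContinuousLinearMap.IsPositive.eq_of_mul_self_eq {H : Type*} [NormedAddCommGroup H]
    [InnerProductSpace ℂ H] [CompleteSpace H] {A B : H →L[ℂ] H} (hA : A.IsPositive)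
    (hB : B.IsPositive) (h : A * A = B * B) : A = B := by
  rw [← CFC.sqrt_unique h ((nonneg_iff_isPositive A).2 hA),
    CFC.sqrt_unique rfl ((nonneg_iff_isPositive B).2 hB)]

/-- A conjugate-linear isometry reverses inner products. -/
theorem inner_map_map_of_conjLinear_isometry {H : Type*} [NormedAddCommGroup H]
    [InnerProductSpace ℂ H] (J : H → H)
    (hJ_add : ∀ x y, J (x + y) = J x + J y)
    (hJ_smul : ∀ (c : ℂ) (x : H), J (c • x) = (starRingEnd ℂ c) • J x)
    (hJ_iso : ∀ x, ‖J x‖ = ‖x‖) (x y : H) :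
    inner ℂ (J x) (J y) = inner ℂ y x := by
  have hre (u v : H) : (inner ℂ (J u) (J v)).re = (inner ℂ u v).re := by
    have h1 := norm_add_sq (𝕜 := ℂ) u v
    have h2 := norm_add_sq (𝕜 := ℂ) (J u) (J v)
    rw [← hJ_add, hJ_iso, hJ_iso, hJ_iso] at h2
    simp only [RCLike.re_to_complex] at h1 h2
    linarith
  rw [← inner_conj_symm y x]
  apply Complex.ext
  · rw [Complex.conj_re, hre]
  · have h := hre x (Complex.I • y)
    rw [hJ_smul, inner_smul_right, inner_smul_right] at h
    rw [Complex.conj_im]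
    simpa using h

/-- A conjugation commuting with `T` commutes with `|T|`. -/
theorem conjugation_comm_abs {H : Type*} [NormedAddCommGroup H]
    [InnerProductSpace ℂ H] [CompleteSpace H] (J : H → H) (T A : H →L[ℂ] H)
    (hJ_add : ∀ x y, J (x + y) = J x + J y)
    (hJ_smul : ∀ (c : ℂ) (x : H), J (c • x) = (starRingEnd ℂ c) • J x)
    (hJ_iso : ∀ x, ‖J x‖ = ‖x‖)
    (hJ_inv : ∀ x, J (J x) = x)
    (hcomm : ∀ x, J (T x) = T (J x))
    (hA : A.IsPositive)
    (hA_sq : A * A = ContinuousLinearMap.adjoint T * T) (x : H) :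
    J (A x) = A (J x) := by
  have hinner := inner_map_map_of_conjLinear_isometry J hJ_add hJ_smul hJ_iso
  have hadj (x : H) : J (ContinuousLinearMap.adjoint T x) =
      ContinuousLinearMap.adjoint T (J x) := by
    refine ext_inner_right ℂ fun y => ?_
    obtain ⟨z, rfl⟩ : ∃ z, J z = y := ⟨J y, hJ_inv y⟩
    rw [ContinuousLinearMap.adjoint_inner_left, hinner,
      ContinuousLinearMap.adjoint_inner_right, ← hcomm, hinner]
  let C : H →L[ℂ] H := LinearMap.mkContinuous
    { toFun := fun x => J (A (J x))
      map_add' := fun x y => by simp [hJ_add]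
      map_smul' := fun c x => by simp [hJ_smul] } ‖A‖ fun x => by
        simpa [hJ_iso] using A.le_opNorm (J x)
  have hC (x : H) : C x = J (A (J x)) := rfl
  have hCpos : C.IsPositive := by
    rw [ContinuousLinearMap.isPositive_iff_complex]
    intro x
    have h := (ContinuousLinearMap.isPositive_iff_complex A).1 hA (J x)
    have hx : inner ℂ (C x) x = inner ℂ (A (J x)) (J x) := by
      conv_lhs => rw [hC, ← hJ_inv x, hinner, hJ_inv x]
      rw [hA.inner_left_eq_inner_right]
    rwa [hx]
  have hCA : C = A := by
    refine hCpos.eq_of_mul_self_eq hA ?_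
    ext x
    have h (y : H) : A (A y) = ContinuousLinearMap.adjoint T (T y) :=
      congrArg (fun S : H →L[ℂ] H => S y) hA_sq
    simp only [mul_apply_eq_comp, hC, hJ_inv, h, hadj, hcomm]
  rw [← hCA, hC, hCA, hJ_inv]

/-- If `T` is an involution with polar decomposition `T = U A`, then `A` is invertible and
`U` is a self-adjoint unitary. -/
theorem polar_of_involution {H : Type*} [NormedAddCommGroup H]
    [InnerProductSpace ℂ H] [CompleteSpace H] (T U A : H →L[ℂ] H)
    (hT : T * T = 1) (hA : A.IsPositive) (hA_sq : A * A = star T * T) (hU : T = U * A) :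
    (∃ B : H →L[ℂ] H, A * B = 1 ∧ B * A = 1) ∧ star U = U ∧ U * U = 1 := by
  have hTs : star T * star T = 1 := by rw [← star_mul, hT, star_one]
  have hAs : star A = A := hA.isSelfAdjoint
  obtain ⟨B, hB⟩ : ∃ B, B = A * (T * star T) := ⟨_, rfl⟩
  have hAB : A * B = 1 := by
    rw [hB, ← mul_assoc, hA_sq, mul_assoc, ← mul_assoc T T, hT, one_mul, hTs]
  have hBA : B * A = 1 := by
    have h : T * star T * A * A = 1 := by
      rw [mul_assoc, hA_sq, mul_assoc, ← mul_assoc (star T), hTs, one_mul, hT]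
    rwa [left_inv_eq_right_inv h hAB] at h
  have hBs : star B = B := by
    have h : star B * A = 1 := by rw [← hAs, ← star_mul, hAB, star_one]
    exact left_inv_eq_right_inv h hAB
  have hUT : U = T * B := by rw [hU, mul_assoc, hAB, mul_one]
  have hUU : star U * U = 1 := by
    rw [hUT, star_mul, hBs, mul_assoc, ← mul_assoc (star T), ← hA_sq, mul_assoc, hAB, mul_one, hBA]
  have hBpos : B.IsPositive := by
    have h : B * (A * star B) = B := by rw [hBs, hAB, mul_one]
    rw [← h]
    exact hA.conj_adjoint B
  have hC : U * (A * star U) = B := by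
    refine (hA.conj_adjoint U : (U * (A * star U)).IsPositive).eq_of_mul_self_eq hBpos ?_
    calc U * (A * star U) * (U * (A * star U))
        = U * A * (star U * U) * (A * star U) := by simp only [mul_assoc]
      _ = U * A * star (U * A) := by rw [hUU, mul_one, star_mul, hAs]
      _ = B * A * (T * star T) := by rw [← hU, hBA, one_mul]
      _ = B * B := by rw [mul_assoc, ← hB]
  have hBU : B * U = T := by
    rw [← hC, mul_assoc, mul_assoc, hUU, mul_one, ← hU]
  have hBUs : B * star U = T := by
    refine left_inv_eq_right_inv (a := T) ?_ hT
    rw [hU, mul_assoc, ← mul_assoc (star U), hUU, one_mul, hBA]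
  have hsa : star U = U := by
    rw [← one_mul (star U), ← hAB, mul_assoc, hBUs, ← hBU, ← mul_assoc, hAB, one_mul]
  exact ⟨⟨B, hAB, hBA⟩, hsa, by rwa [hsa] at hUU⟩


/-- Let `T` be an invertible bounded operator on a complex Hilbert space
with `T² = I` (the hypothesis `T * T = 1` makes `T` invertible), let `J` be a conjugation
with `J T = T J`, and let `U` be the unitary factor in the polar decomposition
`T = U |T|`, where `absT = |T|` is the unique positive square root of `T*T`.
Then the map `𝒥 := J ∘ U` is itself a conjugation on `H`: it is additive,
conjugate-linear, isometric, and an involution. -/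
theorem stmt_8 {H : Type*} [NormedAddCommGroup H] [InnerProductSpace ℂ H] [CompleteSpace H]
    (J : H → H) (T U absT : H →L[ℂ] H)
    (hT : T * T = 1)
    (hJ_add : ∀ x y, J (x + y) = J x + J y)
    (hJ_smul : ∀ (c : ℂ) (x : H), J (c • x) = (starRingEnd ℂ c) • J x)
    (hJ_iso : ∀ x, ‖J x‖ = ‖x‖)
    (hJ_inv : ∀ x, J (J x) = x)
    (hcomm : ∀ x, J (T x) = T (J x))
    (habs_pos : absT.IsPositive)
    (habs_sq : absT * absT = ContinuousLinearMap.adjoint T * T)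
    (hU : T = U * absT) :
    (∀ x y, J (U (x + y)) = J (U x) + J (U y)) ∧
      (∀ (c : ℂ) (x : H), J (U (c • x)) = (starRingEnd ℂ c) • J (U x)) ∧
      (∀ x, ‖J (U x)‖ = ‖x‖) ∧
      (∀ x, J (U (J (U x))) = x) := by
  obtain ⟨⟨B, hAB, hBA⟩, hsa, hUU⟩ := polar_of_involution T U absT hT habs_pos habs_sq hU
  have hJA := conjugation_comm_abs J T absT hJ_add hJ_smul hJ_iso hJ_inv hcomm habs_pos habs_sq
  have hAB' (x : H) : absT (B x) = x := congrArg (fun S : H →L[ℂ] H => S x) hAB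
  have hUU' (x : H) : U (U x) = x := congrArg (fun S : H →L[ℂ] H => S x) hUU
  have hTU (x : H) : T x = U (absT x) := congrArg (fun S : H →L[ℂ] H => S x) hU
  have hJU (x : H) : J (U x) = U (J x) := by
    rw [← hAB' x, ← hTU, hcomm, hTU, hJA]
  refine ⟨fun x y => by rw [map_add, hJ_add], fun c x => by rw [map_smul, hJ_smul],
    fun x => ?_, fun x => by rw [hJU (J (U x)), hJ_inv, hUU']⟩
  rw [hJ_iso]
  refine (U.norm_map_iff_adjoint_comp_self).2 ?_ x
  rw [← ContinuousLinearMap.star_eq_adjoint, hsa]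
  exact hUU
end

section
/- Let H be a complex Hilbert space, let T be an invertible bounded linear operator on H with T² = I, and let W be a unitary operator on H. Suppose J is a conjugation on H that commutes with S := W*∘T∘W, and let U_S be the unitary factor in the polar decomposition of S. Then 𝒥 := W∘(J∘U_S)∘W* is a conjugation on H and T is 𝒥-symmetric: T = 𝒥∘T*∘𝒥. -/
/-- The partial isometry in a polar decomposition of an involution in a C⋆-algebra is a
self-adjoint involution. -/
theorem polar_factor_of_mul_self_eq_one {A : Type*} [CStarAlgebra A] [PartialOrder A]
    [StarOrderedRing A] {s u p : A} (hs : s * s = 1) (hp : 0 ≤ p) (hpp : p * p = star s * s)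
    (hsu : s = u * p) : (∃ q, p * q = 1) ∧ star u = u ∧ u * u = 1 := by
  have hs' : star s * star s = 1 := by rw [← star_mul, hs, star_one]
  have hr : p * (p * (s * star s)) = 1 := by
    rw [← mul_assoc, hpp, mul_assoc, ← mul_assoc s, hs, one_mul, hs']
  have hl : ((s * star s) * p) * p = 1 := by
    rw [mul_assoc, hpp, mul_assoc, ← mul_assoc (star s), hs', one_mul, hs]
  obtain ⟨q, hq⟩ : ∃ q, q = p * (s * star s) := ⟨_, rfl⟩
  rw [← hq] at hr
  have hql : q * p = 1 := by rwa [left_inv_eq_right_inv hl hr] at hl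
  have hpsa : star p = p := (IsSelfAdjoint.of_nonneg hp).star_eq
  have hqsa : star q = q := by
    refine left_inv_eq_right_inv (a := p) ?_ hr
    rw [← hpsa, ← star_mul, hr, star_one]
  have hqnn : 0 ≤ q := by
    simpa [hqsa, hql] using star_left_conjugate_nonneg hp q
  have hqq : q * q = s * star s := by
    nth_rewrite 2 [hq]
    rw [← mul_assoc, hql, one_mul]
  have hpq : (q * (star s * s)) * q = 1 := by
    rw [← hpp, ← mul_assoc, hql, one_mul, hr]
  have hconj : s * q * star s = q := by
    have hsq : (s * q * star s) * (s * q * star s) = q * q := by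
      calc (s * q * star s) * (s * q * star s) = s * ((q * (star s * s)) * q) * star s := by
            simp only [mul_assoc]
        _ = q * q := by rw [hpq, mul_one, hqq]
    rw [← CFC.sqrt_unique hsq (star_right_conjugate_nonneg hqnn s), CFC.sqrt_mul_self q hqnn]
  have hu : u = s * q := by rw [hsu, mul_assoc, hr, mul_one]
  have hcomm : q * star s = s * q := by
    nth_rewrite 1 [← hconj]
    rw [mul_assoc, hs', mul_one]
  refine ⟨⟨q, hr⟩, ?_, ?_⟩
  · rw [hu, star_mul, hqsa, hcomm]
  · rw [hu]
    nth_rewrite 1 [← hcomm]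
    rw [← hpq]
    simp only [mul_assoc]

section Conjugation

open scoped InnerProductSpace

variable {H : Type*} [NormedAddCommGroup H] [InnerProductSpace ℂ H]

/-- A conjugate-linear isometry conjugates inner products. -/
theorem inner_map_map_of_conj_isometry (J : H →ₛₗᵢ[starRingEnd ℂ] H) (x y : H) :
    ⟪J x, J y⟫_ℂ = ⟪y, x⟫_ℂ := by
  have hre (x y : H) : (⟪J x, J y⟫_ℂ).re = (⟪x, y⟫_ℂ).re := by
    have h₁ := norm_add_sq (𝕜 := ℂ) (J x) (J y)
    have h₂ := norm_add_sq (𝕜 := ℂ) x y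
    rw [← map_add, J.norm_map, J.norm_map, J.norm_map] at h₁
    simp only [RCLike.re_to_complex] at h₁ h₂
    linarith
  have him := hre (Complex.I • x) y
  rw [← inner_conj_symm y x]
  apply Complex.ext
  · rw [hre, Complex.conj_re]
  · rw [Complex.conj_im, ← neg_eq_iff_eq_neg]
    simpa [map_smulₛₗ, inner_smul_left] using him

variable [CompleteSpace H]

/-- A conjugation commuting with an operator commutes with its adjoint. -/
theorem conjugation_adjoint_comm (J : H →ₛₗᵢ[starRingEnd ℂ] H) (hJ : ∀ x, J (J x) = x)
    {S : H →L[ℂ] H} (hS : ∀ x, J (S x) = S (J x)) (x : H) :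
    J (S.adjoint x) = S.adjoint (J x) := by
  refine ext_inner_right ℂ fun y => ?_
  rw [ContinuousLinearMap.adjoint_inner_left]
  calc ⟪J (S.adjoint x), y⟫_ℂ = ⟪J (S.adjoint x), J (J y)⟫_ℂ := by rw [hJ]
    _ = ⟪S (J y), x⟫_ℂ := by
      rw [inner_map_map_of_conj_isometry, ContinuousLinearMap.adjoint_inner_right]
    _ = ⟪J x, S y⟫_ℂ := by rw [← inner_map_map_of_conj_isometry J, hS, hJ]

/-- A conjugation commuting with the square of a positive operator commutes with the operator. -/
theorem conjugation_comm_of_comm_mul_self (J : H →ₛₗᵢ[starRingEnd ℂ] H) (hJ : ∀ x, J (J x) = x)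
    {P : H →L[ℂ] H} (hP : P.IsPositive) (hPP : ∀ x, J (P (P x)) = P (P (J x))) (x : H) :
    J (P x) = P (J x) := by
  let Q : H →L[ℂ] H :=
    J.toContinuousLinearMap.comp (P.comp J.toContinuousLinearMap)
  have hQ_apply (x : H) : Q x = J (P (J x)) := rfl
  have hQ : Q.IsPositive := by
    refine (ContinuousLinearMap.isPositive_iff_complex Q).2 fun x => ?_
    have h : ⟪Q x, x⟫_ℂ = ⟪P (J x), J x⟫_ℂ := by
      rw [hQ_apply, ← inner_map_map_of_conj_isometry J, hJ]
      exact (ContinuousLinearMap.isSelfAdjoint_iff_isSymmetric.1 hP.isSelfAdjoint _ _).symm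
    rw [h]
    exact (ContinuousLinearMap.isPositive_iff_complex P).1 hP (J x)
  have hQQ : Q * Q = P * P := by
    ext x
    simp only [mul_apply_eq_comp, hQ_apply, hJ, hPP]
  have hQP : Q = P := by
    have hQ' := (ContinuousLinearMap.nonneg_iff_isPositive Q).2 hQ
    have hP' := (ContinuousLinearMap.nonneg_iff_isPositive P).2 hP
    rw [← CFC.sqrt_unique hQQ hQ', CFC.sqrt_mul_self P hP']
  rw [← hJ x, ← hQ_apply, hQP, hJ]

end Conjugation


/-- Let `T` be an invertible bounded operator on a complex Hilbert
space `H` with `T² = I` (the hypothesis `T * T = 1` makes `T` invertible), and let `W`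
be a unitary operator on `H`.  Suppose `J` is a conjugation on `H` (an additive,
conjugate-linear, isometric involution) that commutes with `S := W* ∘ T ∘ W`, and let
`US` be the unitary factor in the polar decomposition `S = US |S|`, where `absS = |S|`
is the unique positive square root of `S*S` (this determines `US` since `|S|` is
invertible here).  Then `𝒥 := W ∘ (J ∘ US) ∘ W*` is a conjugation on `H` and `T` is
`𝒥`-symmetric: `T = 𝒥 ∘ T* ∘ 𝒥`. -/
theorem stmt_11 {H : Type*} [NormedAddCommGroup H] [InnerProductSpace ℂ H] [CompleteSpace H]
    (J : H → H) (T W S US absS : H →L[ℂ] H)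
    (hT : T * T = 1)
    (hW₁ : ContinuousLinearMap.adjoint W * W = 1)
    (hW₂ : W * ContinuousLinearMap.adjoint W = 1)
    (hS : S = ContinuousLinearMap.adjoint W ∘L T ∘L W)
    (hJ_add : ∀ x y, J (x + y) = J x + J y)
    (hJ_smul : ∀ (c : ℂ) (x : H), J (c • x) = (starRingEnd ℂ c) • J x)
    (hJ_iso : ∀ x, ‖J x‖ = ‖x‖)
    (hJ_inv : ∀ x, J (J x) = x)
    (hcomm : ∀ x, J (S x) = S (J x))
    (habsS_pos : absS.IsPositive)
    (habsS_sq : absS * absS = ContinuousLinearMap.adjoint S * S)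
    (hUS : S = US * absS) :
    (∀ x y, W (J (US (ContinuousLinearMap.adjoint W (x + y))))
        = W (J (US (ContinuousLinearMap.adjoint W x)))
          + W (J (US (ContinuousLinearMap.adjoint W y)))) ∧
      (∀ (c : ℂ) (x : H), W (J (US (ContinuousLinearMap.adjoint W (c • x))))
        = (starRingEnd ℂ c) • W (J (US (ContinuousLinearMap.adjoint W x)))) ∧
      (∀ x, ‖W (J (US (ContinuousLinearMap.adjoint W x)))‖ = ‖x‖) ∧
      (∀ x, W (J (US (ContinuousLinearMap.adjoint W
          (W (J (US (ContinuousLinearMap.adjoint W x))))))) = x) ∧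
      (∀ x, T x = W (J (US (ContinuousLinearMap.adjoint W
          (ContinuousLinearMap.adjoint T
            (W (J (US (ContinuousLinearMap.adjoint W x))))))))) := by
  let K : H →ₛₗᵢ[starRingEnd ℂ] H :=
    { toFun := J, map_add' := hJ_add, map_smul' := hJ_smul, norm_map' := hJ_iso }
  have hWW (x : H) : W.adjoint (W x) = x := congrArg (· x) hW₁
  have hWW' (x : H) : W (W.adjoint x) = x := congrArg (· x) hW₂
  have hS_apply (x : H) : S x = W.adjoint (T (W x)) := by rw [hS]; rfl
  have hSS : S * S = 1 := by
    ext x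
    have hTT : T (T (W x)) = W x := congrArg (· (W x)) hT
    simp only [mul_apply_eq_comp, hS_apply, hWW', hTT, hWW,
      one_apply_eq_self]
  obtain ⟨⟨q, hq⟩, hUsa, hUU⟩ := polar_factor_of_mul_self_eq_one hSS
    ((ContinuousLinearMap.nonneg_iff_isPositive absS).2 habsS_pos) habsS_sq hUS
  have hUU_apply (x : H) : US (US x) = x := congrArg (· x) hUU
  have hS_polar (x : H) : S x = US (absS x) := congrArg (· x) hUS
  have hJP (x : H) : J (absS x) = absS (J x) := by
    refine conjugation_comm_of_comm_mul_self K hJ_inv habsS_pos (fun x => ?_) x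
    have hPP (y : H) : absS (absS y) = S.adjoint (S y) := congrArg (· y) habsS_sq
    rw [hPP, hPP, conjugation_adjoint_comm K hJ_inv hcomm]
    exact congrArg S.adjoint (hcomm x)
  have hJU (x : H) : J (US x) = US (J x) := by
    have hqx : absS (q x) = x := congrArg (· x) hq
    rw [← hqx, ← hS_polar, hcomm, hS_polar, hJP]
  have hU_norm (x : H) : ‖US x‖ = ‖x‖ := by
    refine (ContinuousLinearMap.norm_map_iff_adjoint_comp_self US).2 ?_ x
    have h : star US * US = 1 := by rw [hUsa, hUU]
    exact h
  have hW_norm (x : H) : ‖W x‖ = ‖x‖ :=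
    (ContinuousLinearMap.norm_map_iff_adjoint_comp_self W).2 hW₁ x
  refine ⟨fun x y => ?_, fun c x => ?_, fun x => ?_, fun x => ?_, fun x => ?_⟩
  · simp only [map_add, hJ_add]
  · simp only [map_smul, hJ_smul]
  · rw [hW_norm, hJ_iso, hU_norm, ← hW_norm, hWW']
  · rw [hWW, hJU, hJ_inv, hUU_apply, hWW']
  · have hSadj (y : H) : S.adjoint y = W.adjoint (T.adjoint (W y)) := by
      simp only [hS, ContinuousLinearMap.adjoint_comp, ContinuousLinearMap.adjoint_adjoint,
        ContinuousLinearMap.comp_apply]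
    have hSadj_polar (y : H) : S.adjoint y = absS (US y) := by
      have h : star S = absS * US := by
        rw [hUS, star_mul, hUsa, habsS_pos.isSelfAdjoint.star_eq]
      exact congrArg (· y) h
    rw [← hSadj, hSadj_polar, hJU, hJP, hJU, hJ_inv, hUU_apply, ← hS_polar, hS_apply, hWW', hWW']
end
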